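/- For all integers a ≥ 2 and all integers n ≥ 503, ex_Π(n, 6, 15a + 7) = Π_{2,1}(a, n). (Here 15a + 7 = C(6,2)·a + 7 = Σ_{2,1}(a,6).) -/

import Mathlib

open Finset

/-- Sum of the edge multiplicities of the multigraph `w` inside the vertex set `X`
(edges are 2-element subsets of `Fin n`). -/
def edgeSum (n : ℕ) (w : Finset (Fin n) → ℕ) (X : Finset (Fin n)) : ℕ :=
  ∑ p ∈ X.powersetCard 2, w p

/-- Product of the edge multiplicities of the multigraph `w` inside the vertex set `X`. -/
def edgeProd (n : ℕ) (w : Finset (Fin n) → ℕ) (X : Finset (Fin n)) : ℕ :=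
  ∏ p ∈ X.powersetCard 2, w p

/-- The product-degree of the vertex `v` in the multigraph `w`. -/
def pdeg (n : ℕ) (w : Finset (Fin n) → ℕ) (v : Fin n) : ℕ :=
  ∏ u ∈ Finset.univ.erase v, w {u, v}

/-- `w` is an `(n,s,q)`-graph: every `s`-set of vertices spans at most `q` edges. -/
def IsF (n s q : ℕ) (w : Finset (Fin n) → ℕ) : Prop :=
  ∀ X : Finset (Fin n), X.card = s → edgeSum n w X ≤ q

/-- `ex_Π(n,s,q)`: the maximum of the product of all edge multiplicities over
`(n,s,q)`-graphs. -/
noncomputable def exPi (n s q : ℕ) : ℕ :=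
  sSup {P | ∃ w : Finset (Fin n) → ℕ, IsF n s q w ∧ P = edgeProd n w Finset.univ}

/-- Membership in the family `T_{r,d}(a,n)`: the vertex set can be partitioned into
parts `V_0, …, V_{r-1}` (given by a labelling `f`) so that edges inside `V_0` have
multiplicity `a - d`, edges inside `V_i` (`i ≥ 1`) have multiplicity `a`, and edges
between distinct parts have multiplicity `a + 1`. -/
def InT (n r d a : ℕ) (w : Finset (Fin n) → ℕ) : Prop :=
  ∃ f : Fin n → ℕ, (∀ v, f v < r) ∧
    ∀ u v : Fin n, u ≠ v →
      w {u, v} = if f u = f v then (if f u = 0 then a - d else a) else a + 1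

/-- `Σ_{r,d}(a,n)`: the maximum number of edges of a member of `T_{r,d}(a,n)`. -/
noncomputable def SigmaT (r d a n : ℕ) : ℕ :=
  sSup {e | ∃ w : Finset (Fin n) → ℕ, InT n r d a w ∧ e = edgeSum n w Finset.univ}

/-- `Π_{r,d}(a,n)`: the maximum product of edge multiplicities of a member of
`T_{r,d}(a,n)`. -/
noncomputable def PiT (r d a n : ℕ) : ℕ :=
  sSup {P | ∃ w : Finset (Fin n) → ℕ, InT n r d a w ∧ P = edgeProd n w Finset.univ}

/-- Twice the (relative logarithmic) weight of a member of `T_{2,1}` on `m` vertices with `k`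
vertices in the sparse part, where the sparse edges have weight `-θ` and the crossing edges `1`. -/
def splitWeight (θ m k : ℝ) : ℝ := 2 * k * (m - k) - θ * k * (k - 1)

/-- The size of the sparse part that maximises `splitWeight θ m`. -/
noncomputable def bestSplit (θ : ℝ) (m : ℕ) : ℕ := ⌈((m : ℝ) - 1) / (2 + θ)⌉₊

/-- The maximum of `splitWeight θ m` over natural numbers. -/
noncomputable def maxSplitWeight (θ : ℝ) (m : ℕ) : ℝ := splitWeight θ m (bestSplit θ m)

lemma le_bestSplit {θ : ℝ} (hθ : 1 ≤ θ) (m : ℕ) : (m : ℝ) - 1 ≤ (2 + θ) * bestSplit θ m := by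
  have h := Nat.le_ceil (((m : ℝ) - 1) / (2 + θ))
  rw [div_le_iff₀ (by linarith)] at h
  unfold bestSplit
  linarith

lemma bestSplit_le {θ : ℝ} (hθ : 1 ≤ θ) {m : ℕ} (hm : 1 ≤ m) :
    (2 + θ) * bestSplit θ m ≤ m + 1 + θ := by
  have hm' : (1 : ℝ) ≤ m := by exact_mod_cast hm
  have h := (Nat.ceil_lt_add_one (a := ((m : ℝ) - 1) / (2 + θ))
    (div_nonneg (by linarith) (by linarith))).le
  have h2 : ((m : ℝ) - 1) / (2 + θ) * (2 + θ) = m - 1 := div_mul_cancel₀ _ (by linarith)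
  unfold bestSplit
  nlinarith

lemma bestSplit_le_self {θ : ℝ} (hθ : 1 ≤ θ) {m : ℕ} (hm : 1 ≤ m) : bestSplit θ m ≤ m := by
  have hm' : (1 : ℝ) ≤ m := by exact_mod_cast hm
  refine Nat.ceil_le.2 ?_
  rw [div_le_iff₀ (by linarith)]
  nlinarith

lemma splitWeight_le_max {θ : ℝ} (hθ : 1 ≤ θ) {m : ℕ} (hm : 1 ≤ m) (j : ℕ) :
    splitWeight θ m j ≤ maxSplitWeight θ m := by
  have h1 := le_bestSplit hθ m
  have h2 := bestSplit_le hθ hm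
  unfold maxSplitWeight splitWeight
  set k := bestSplit θ m
  rcases lt_trichotomy j k with h | h | h
  · have h' : (j : ℝ) + 1 ≤ k := by exact_mod_cast h
    have : 0 ≤ ((k : ℝ) - j) * (2 * m - (2 + θ) * (j + k) + θ) :=
      mul_nonneg (by linarith) (by nlinarith)
    nlinarith
  · rw [h]
  · have h' : (k : ℝ) + 1 ≤ j := by exact_mod_cast h
    have : 0 ≤ ((j : ℝ) - k) * ((2 + θ) * (j + k) - θ - 2 * m) :=
      mul_nonneg (by linarith) (by nlinarith)
    nlinarith

lemma le_maxSplitWeight {θ : ℝ} (hθ : 1 ≤ θ) {m : ℕ} (hm : 1 ≤ m) :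
    (m : ℝ) ^ 2 + θ * m - (1 + θ) ≤ (2 + θ) * maxSplitWeight θ m := by
  have h1 := le_bestSplit hθ m
  have h2 := bestSplit_le hθ hm
  unfold maxSplitWeight splitWeight
  set k : ℝ := ((bestSplit θ m : ℕ) : ℝ)
  nlinarith [mul_nonneg (sub_nonneg.2 h1) (sub_nonneg.2 h2)]

/-- The real weight of a pair of sign `1`, `0` or `-1`. -/
def signWeight (θ : ℝ) (s : SignType) : ℝ := if s = 1 then 1 else if s = -1 then -θ else 0

/-- A sign pattern on pairs of vertices (with `-1` on the diagonal) whose positive pairs form no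
triangle, and in which every positive four-cycle has a negative diagonal. -/
structure IsSignPattern {V : Type*} (c : V → V → SignType) : Prop where
  symm : ∀ u v, c u v = c v u
  diag : ∀ u, c u u = -1
  triangle : ∀ u v w, c u v = 1 → c v w = 1 → c u w ≠ 1
  cycle : ∀ x u y v, c x u = 1 → c u y = 1 → c y v = 1 → c v x = 1 → c x y = -1 ∨ c u v = -1

lemma IsSignPattern.comap {V W : Type*} {c : V → V → SignType} (hc : IsSignPattern c)
    (σ : W → V) : IsSignPattern fun x y => c (σ x) (σ y) where
  symm _ _ := hc.symm _ _
  diag _ := hc.diag _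
  triangle _ _ _ := hc.triangle _ _ _
  cycle _ _ _ _ := hc.cycle _ _ _ _

section Extremal

variable {V : Type*} [Fintype V] {θ : ℝ} {c : V → V → SignType}

/-- The total weight of a sign pattern over ordered pairs, the diagonal included. -/
def patternWeight (θ : ℝ) (c : V → V → SignType) : ℝ := ∑ x, ∑ y, signWeight θ (c x y)

/-- The total weight of the pairs at a vertex, the diagonal included. -/
def vertexWeight (θ : ℝ) (c : V → V → SignType) (x : V) : ℝ := ∑ y, signWeight θ (c x y)

/-- The vertices joined to `x` by a positive pair. -/
def posNbhd (c : V → V → SignType) (x : V) : Finset V := univ.filter fun y => c x y = 1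

/-- The vertices joined to `x` by a negative pair, including `x` itself. -/
def negNbhd (c : V → V → SignType) (x : V) : Finset V := univ.filter fun y => c x y = -1

lemma mem_posNbhd {x y : V} : y ∈ posNbhd c x ↔ c x y = 1 := by simp [posNbhd]

lemma mem_negNbhd {x y : V} : y ∈ negNbhd c x ↔ c x y = -1 := by simp [negNbhd]

lemma signWeight_le_one (hθ : 1 ≤ θ) (s : SignType) : signWeight θ s ≤ 1 := by
  unfold signWeight; split_ifs <;> linarith

lemma signWeight_eq (s : SignType) :
    signWeight θ s = (if s = 1 then 1 else 0) - θ * (if s = -1 then 1 else 0) := by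
  cases s <;> simp [signWeight]

lemma vertexWeight_eq (x : V) :
    vertexWeight θ c x = (posNbhd c x).card - θ * (negNbhd c x).card := by
  simp only [vertexWeight, signWeight_eq, Finset.sum_sub_distrib, ← Finset.mul_sum,
    Finset.sum_boole, posNbhd, negNbhd]

lemma IsSignPattern.mem_negNbhd_self (hc : IsSignPattern c) (x : V) : x ∈ negNbhd c x :=
  mem_negNbhd.2 (hc.diag x)

lemma IsSignPattern.card_negNbhd_pos (hc : IsSignPattern c) (x : V) : 0 < (negNbhd c x).card :=
  Finset.card_pos.2 ⟨x, hc.mem_negNbhd_self x⟩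

lemma disjoint_negNbhd_posNbhd (x : V) : Disjoint (negNbhd c x) (posNbhd c x) := by
  rw [Finset.disjoint_left]
  intro y h1 h2
  rw [mem_negNbhd] at h1
  rw [mem_posNbhd, h1] at h2
  exact absurd h2 (by decide)

variable [DecidableEq V]

/-- A sign pattern of maximum total weight. -/
structure IsMaxPattern (θ : ℝ) (c : V → V → SignType) : Prop extends IsSignPattern c where
  le : ∀ c' : V → V → SignType, IsSignPattern c' → patternWeight θ c' ≤ patternWeight θ c

lemma exists_isMaxPattern (θ : ℝ) (hc : IsSignPattern c) :
    ∃ c' : V → V → SignType, IsMaxPattern θ c' ∧ patternWeight θ c ≤ patternWeight θ c' := by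
  classical
  obtain ⟨c', hc', h⟩ := Finset.exists_max_image
    (univ.filter fun c : V → V → SignType => IsSignPattern c) (patternWeight θ) ⟨c, by simpa⟩
  simp only [mem_filter, mem_univ, true_and] at hc' h
  exact ⟨c', ⟨hc', h⟩, h c hc⟩

lemma sum_comp_update (φ : V → ℝ) (u v : V) :
    ∑ x, φ (Function.update id u v x) = ∑ x, φ x + φ v - φ u := by
  have h : ∀ x, φ (Function.update id u v x) = φ x + if x = u then φ v - φ u else 0 := by
    intro x
    by_cases h : x = u
    · subst h; simp
    · simp [h]
  simp only [h, Finset.sum_add_distrib, Finset.sum_ite_eq', mem_univ, if_true]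
  ring

lemma sum_comp_update_update (φ : V → ℝ) {x z : V} (hxz : x ≠ z) (y : V) :
    ∑ t, φ (Function.update (Function.update id x y) z y t)
      = ∑ t, φ t + 2 * φ y - φ x - φ z := by
  have h : ∀ t, φ (Function.update (Function.update id x y) z y t)
      = φ t + (if t = x then φ y - φ x else 0) + if t = z then φ y - φ z else 0 := by
    intro t
    by_cases h : t = z
    · subst h; simp [hxz.symm]
    · by_cases h' : t = x
      · subst h'; simp [h]
      · simp [h, h']
  simp only [h, Finset.sum_add_distrib, Finset.sum_ite_eq', mem_univ, if_true]
  ring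

lemma IsMaxPattern.vertexWeight_le (hc : IsMaxPattern θ c) (u v : V) :
    vertexWeight θ c v ≤ vertexWeight θ c u + θ + signWeight θ (c u v) := by
  have h := hc.le _ (hc.toIsSignPattern.comap (Function.update id u v))
  unfold patternWeight at h
  have h1 : ∀ b, ∑ y, signWeight θ (c b (Function.update id u v y))
      = vertexWeight θ c b + signWeight θ (c b v) - signWeight θ (c b u) :=
    fun b => sum_comp_update (fun y => signWeight θ (c b y)) u v
  simp only [h1] at h
  rw [sum_comp_update
    (fun b => vertexWeight θ c b + signWeight θ (c b v) - signWeight θ (c b u))] at h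
  simp only [Finset.sum_add_distrib, Finset.sum_sub_distrib] at h
  have h2 : ∀ w, ∑ x, signWeight θ (c x w) = vertexWeight θ c w := fun w => by
    simp only [vertexWeight, hc.symm _ w]
  have h3 : ∑ x, vertexWeight θ c x = ∑ x, ∑ y, signWeight θ (c x y) := rfl
  have h4 : signWeight θ (-1) = -θ := by simp [signWeight]
  rw [h2, h2, h3, hc.diag, hc.diag, hc.symm v u, h4] at h
  linarith

lemma IsMaxPattern.trans (hθ : 1 ≤ θ) (hc : IsMaxPattern θ c) {x y z : V} (hxy : c x y = -1)
    (hyz : c y z = -1) : c x z = -1 := by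
  by_contra hxz
  have hne : x ≠ z := fun h => hxz (h ▸ hc.diag x)
  have h4 : signWeight θ (-1) = -θ := by simp [signWeight]
  have h5 : 0 ≤ signWeight θ (c x z) := by
    unfold signWeight; split_ifs <;> simp_all
  have h := hc.le _ (hc.toIsSignPattern.comap (Function.update (Function.update id x y) z y))
  have d1 := hc.vertexWeight_le y x
  have d2 := hc.vertexWeight_le y z
  rw [hc.symm y x, hxy, h4] at d1
  rw [hyz, h4] at d2
  unfold patternWeight at h
  have h1 : ∀ b, ∑ t, signWeight θ (c b (Function.update (Function.update id x y) z y t))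
      = vertexWeight θ c b + 2 * signWeight θ (c b y) - signWeight θ (c b x)
        - signWeight θ (c b z) :=
    fun b => sum_comp_update_update (fun y => signWeight θ (c b y)) hne y
  simp only [h1] at h
  rw [sum_comp_update_update (fun b => vertexWeight θ c b + 2 * signWeight θ (c b y)
    - signWeight θ (c b x) - signWeight θ (c b z)) hne] at h
  simp only [Finset.sum_add_distrib, Finset.sum_sub_distrib, ← Finset.mul_sum] at h
  have h2 : ∀ w, ∑ x, signWeight θ (c x w) = vertexWeight θ c w := fun w => by
    simp only [vertexWeight, hc.symm _ w]
  have h3 : ∑ x, vertexWeight θ c x = ∑ x, ∑ y, signWeight θ (c x y) := rfl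
  rw [h2, h2, h2, h3] at h
  simp only [hc.diag, hc.symm z y, hc.symm y x, hc.symm z x, hxy, hyz, h4] at h
  linarith

lemma IsMaxPattern.negNbhd_eq (hθ : 1 ≤ θ) (hc : IsMaxPattern θ c) {x y : V} (hxy : c x y = -1) :
    negNbhd c x = negNbhd c y := by
  ext z
  rw [mem_negNbhd, mem_negNbhd]
  exact ⟨hc.trans hθ (hc.symm x y ▸ hxy), hc.trans hθ hxy⟩

/-- The positive neighbourhoods of the positive neighbours of `u` are essentially disjoint. -/
lemma IsMaxPattern.sum_inv_card_le (hθ : 1 ≤ θ) (hc : IsMaxPattern θ c) (u : V) :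
    ∑ v ∈ posNbhd c u, (((posNbhd c v \ negNbhd c u).card : ℝ) / (negNbhd c v).card)
      ≤ Fintype.card V - (negNbhd c u).card - (posNbhd c u).card := by
  have hL : ∀ v, (((posNbhd c v \ negNbhd c u).card : ℝ) / (negNbhd c v).card)
      = ∑ y, if c v y = 1 ∧ c u y ≠ -1 then ((negNbhd c v).card : ℝ)⁻¹ else 0 := by
    intro v
    rw [← Finset.sum_filter, Finset.sum_const, nsmul_eq_mul, div_eq_mul_inv]
    congr 3
    ext y; simp [mem_posNbhd, mem_negNbhd]
  simp only [hL]
  rw [Finset.sum_comm]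
  have hR : (Fintype.card V - (negNbhd c u).card - (posNbhd c u).card : ℝ)
      = ∑ y ∈ univ \ (negNbhd c u ∪ posNbhd c u), (1 : ℝ) := by
    rw [Finset.sum_const, nsmul_eq_mul, mul_one, Finset.card_sdiff_of_subset (subset_univ _),
      Finset.card_union_of_disjoint (disjoint_negNbhd_posNbhd u), Nat.cast_sub, Nat.cast_add,
      Finset.card_univ]
    · ring
    · rw [← Finset.card_union_of_disjoint (disjoint_negNbhd_posNbhd u)]
      exact Finset.card_le_univ _
  rw [hR, ← Finset.sum_subset (subset_univ (univ \ (negNbhd c u ∪ posNbhd c u)))]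
  · refine Finset.sum_le_sum fun y hy => ?_
    simp only [mem_sdiff, mem_univ, true_and, mem_union, mem_negNbhd, mem_posNbhd, not_or] at hy
    rw [← Finset.sum_filter]
    rcases (filter (fun v => c v y = 1 ∧ c u y ≠ -1) (posNbhd c u)).eq_empty_or_nonempty with
      h | ⟨v₀, h⟩
    · rw [h]; simp
    · simp only [mem_filter, mem_posNbhd] at h
      have key : ∀ v ∈ filter (fun v => c v y = 1 ∧ c u y ≠ -1) (posNbhd c u), c v₀ v = -1 := by
        intro v hv
        simp only [mem_filter, mem_posNbhd] at hv
        rcases hc.cycle v₀ y v u h.2.1 (hc.symm v y ▸ hv.2.1) (hc.symm u v ▸ hv.1) h.1 with h' | h'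
        · exact h'
        · exact absurd (hc.symm y u ▸ h') hy.1
      rw [Finset.sum_congr rfl fun v hv => by rw [← hc.negNbhd_eq hθ (key v hv)],
        Finset.sum_const, nsmul_eq_mul]
      have hpos : (0 : ℝ) < (negNbhd c v₀).card := by exact_mod_cast hc.card_negNbhd_pos v₀
      rw [← div_eq_mul_inv, div_le_one hpos]
      exact_mod_cast Finset.card_le_card fun v hv => mem_negNbhd.2 (key v hv)
  · intro y _ hy
    simp only [mem_sdiff, mem_univ, true_and, mem_union, mem_negNbhd, mem_posNbhd,
      not_not] at hy
    refine Finset.sum_eq_zero fun v hv => if_neg ?_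
    rw [mem_posNbhd] at hv
    rintro ⟨h1, h2⟩
    exact hc.triangle u v y hv h1 (hy.resolve_left h2)

/-- If each vertex outside the negative clique `negNbhd c u` has few positive neighbours outside
it, the pattern weighs no more than the corresponding member of `T_{2,1}`. -/
lemma IsMaxPattern.patternWeight_le_splitWeight (hθ : 1 ≤ θ) (hc : IsMaxPattern θ c) (u : V)
    (hdeg : ∀ x ∉ negNbhd c u, (posNbhd c x \ negNbhd c u).card ≤ (negNbhd c u).card) :
    patternWeight θ c + θ * Fintype.card V
      ≤ splitWeight θ (Fintype.card V) (negNbhd c u).card := by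
  set U := negNbhd c u with hU
  set μ : ℝ := ((U.card : ℕ) : ℝ) with hμ
  have hμ0 : 0 < μ := by simpa [hμ, hU] using hc.card_negNbhd_pos u
  have hmemU : ∀ x, x ∈ U → negNbhd c x = U := fun x hx =>
    (hc.negNbhd_eq hθ (mem_negNbhd.1 hx)).symm
  let inn : V → ℝ := fun x => ((posNbhd c x ∩ U).card : ℝ)
  let out : V → ℝ := fun x => ((posNbhd c x \ U).card : ℝ)
  have hsplit : ∀ x, ((posNbhd c x).card : ℝ) = inn x + out x := fun x => by
    simp only [inn, out]
    exact_mod_cast (Finset.card_inter_add_card_sdiff _ _).symm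
  have hcross : ∑ x ∈ U, out x = ∑ x ∈ Uᶜ, inn x := by
    have e1 : ∀ x, out x = ∑ y ∈ Uᶜ, if c x y = 1 then (1 : ℝ) else 0 := fun x => by
      simp only [out, Finset.sum_boole]
      congr 2; ext y; simp [mem_posNbhd, and_comm]
    have e2 : ∀ x, inn x = ∑ y ∈ U, if c x y = 1 then (1 : ℝ) else 0 := fun x => by
      simp only [inn, Finset.sum_boole]
      congr 2; ext y; simp [mem_posNbhd, and_comm]
    simp only [e1, e2]
    rw [Finset.sum_comm]
    simp only [hc.symm]
  have hinU : ∑ x ∈ U, inn x = 0 := by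
    refine Finset.sum_eq_zero fun x hx => ?_
    simp only [inn]
    rw [← hmemU x hx, Finset.inter_comm,
      Finset.disjoint_iff_inter_eq_empty.1 (disjoint_negNbhd_posNbhd x)]
    simp
  have hout : μ * ∑ x ∈ Uᶜ, out x ≤ μ * (2 * ∑ x ∈ Uᶜ, (μ - inn x)) := by
    have e1 : ∀ x, out x = ∑ y ∈ Uᶜ, if c x y = 1 then (1 : ℝ) else 0 := fun x => by
      simp only [out, Finset.sum_boole]
      congr 2; ext y; simp [mem_posNbhd, and_comm]
    have hedge : ∀ x y, c x y = 1 → μ ≤ (μ - inn x) + (μ - inn y) := by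
      intro x y hxy
      have : (posNbhd c x ∩ U).card + (posNbhd c y ∩ U).card ≤ U.card := by
        rw [← Finset.card_union_of_disjoint]
        · exact Finset.card_le_card (Finset.union_subset inter_subset_right inter_subset_right)
        · rw [Finset.disjoint_left]
          intro z h1 h2
          simp only [mem_inter, mem_posNbhd] at h1 h2
          exact hc.triangle x y z hxy h2.1 h1.1
      have : inn x + inn y ≤ μ := by simp only [inn, hμ]; exact_mod_cast this
      linarith
    have hnn : ∀ x, 0 ≤ μ - inn x := fun x => by
      have : (posNbhd c x ∩ U).card ≤ U.card := Finset.card_le_card inter_subset_right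
      simp only [inn, hμ, sub_nonneg]; exact_mod_cast this
    calc μ * ∑ x ∈ Uᶜ, out x
        = ∑ x ∈ Uᶜ, ∑ y ∈ Uᶜ, if c x y = 1 then μ else 0 := by
          simp only [e1, Finset.mul_sum, mul_ite, mul_one, mul_zero]
      _ ≤ ∑ x ∈ Uᶜ, ∑ y ∈ Uᶜ, ((if c x y = 1 then μ - inn x else 0)
            + if c y x = 1 then μ - inn y else 0) := by
          refine Finset.sum_le_sum fun x _ => Finset.sum_le_sum fun y _ => ?_
          rw [hc.symm y x]
          split_ifs with h
          · exact hedge x y h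
          · simp
      _ = 2 * ∑ x ∈ Uᶜ, ∑ y ∈ Uᶜ, if c x y = 1 then μ - inn x else 0 := by
          simp only [Finset.sum_add_distrib]
          rw [Finset.sum_comm (f := fun x y => if c y x = 1 then μ - inn y else 0)]
          ring
      _ = 2 * ∑ x ∈ Uᶜ, out x * (μ - inn x) := by
          simp only [e1, Finset.sum_mul, ite_mul, one_mul, zero_mul]
      _ ≤ 2 * ∑ x ∈ Uᶜ, μ * (μ - inn x) := by
          gcongr with x hx
          · exact hnn x
          · simp only [out, hμ]
            exact_mod_cast hdeg x (Finset.mem_compl.1 hx)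
      _ = μ * (2 * ∑ x ∈ Uᶜ, (μ - inn x)) := by rw [← Finset.mul_sum]; ring
  have hout' := le_of_mul_le_mul_left hout hμ0
  have hcompl : ((Uᶜ).card : ℝ) = Fintype.card V - μ := by
    rw [Finset.card_compl, Nat.cast_sub (Finset.card_le_univ _)]
  rw [Finset.sum_sub_distrib, Finset.sum_const, nsmul_eq_mul, hcompl] at hout'
  have hneg : (μ * μ + (Fintype.card V - μ) : ℝ) ≤ ∑ x, ((negNbhd c x).card : ℝ) := by
    rw [← Finset.sum_add_sum_compl U]
    refine add_le_add ?_ ?_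
    · rw [Finset.sum_congr rfl fun x hx => by rw [hmemU x hx], Finset.sum_const, nsmul_eq_mul]
    · rw [← hcompl]
      have : ∑ x ∈ Uᶜ, (1 : ℝ) ≤ ∑ x ∈ Uᶜ, ((negNbhd c x).card : ℝ) :=
        Finset.sum_le_sum fun x _ => by exact_mod_cast hc.card_negNbhd_pos x
      simpa using this
  have htot : patternWeight θ c
      = ∑ x, ((posNbhd c x).card : ℝ) - θ * ∑ x, ((negNbhd c x).card : ℝ) := by
    rw [Finset.mul_sum, ← Finset.sum_sub_distrib]
    exact Finset.sum_congr rfl fun x _ => vertexWeight_eq x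
  have hpos : ∑ x, ((posNbhd c x).card : ℝ)
      = ∑ x ∈ U, inn x + ∑ x ∈ U, out x + (∑ x ∈ Uᶜ, inn x + ∑ x ∈ Uᶜ, out x) := by
    rw [← Finset.sum_add_sum_compl U]
    simp only [hsplit, Finset.sum_add_distrib]
  rw [htot, hpos, hinU, hcross]
  unfold splitWeight
  nlinarith [mul_le_mul_of_nonneg_left hneg (by linarith : (0 : ℝ) ≤ θ)]

lemma IsMaxPattern.patternWeight_le (hθ : 1 ≤ θ) (hθ' : θ ≤ 12 / 7) (hc : IsMaxPattern θ c)
    (hV : 120 ≤ Fintype.card V) :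
    patternWeight θ c + θ * Fintype.card V ≤ maxSplitWeight θ (Fintype.card V) := by
  by_contra! hlt
  have hm : (120 : ℝ) ≤ Fintype.card V := by exact_mod_cast hV
  have hmax := le_maxSplitWeight hθ (m := Fintype.card V) (by omega)
  have hsplitle := splitWeight_le_max hθ (m := Fintype.card V) (by omega)
  set m : ℝ := ((Fintype.card V : ℕ) : ℝ) with hmdef
  have : Nonempty V := Fintype.card_pos_iff.1 (by omega)
  obtain ⟨u, -, hu⟩ := Finset.exists_max_image univ (fun x => (negNbhd c x).card) univ_nonempty
  obtain ⟨t, -, ht⟩ := Finset.exists_max_image univ (vertexWeight θ c) univ_nonempty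
  have havg : patternWeight θ c ≤ m * vertexWeight θ c t := by
    have := Finset.sum_le_card_nsmul univ (vertexWeight θ c) _ ht
    rwa [nsmul_eq_mul, Finset.card_univ] at this
  obtain ⟨D, hD⟩ : ∃ D, D = vertexWeight θ c t - θ - 1 := ⟨_, rfl⟩
  have hdeg : ∀ x, D + θ * (negNbhd c x).card ≤ (posNbhd c x).card := fun x => by
    have h1 := hc.vertexWeight_le x t
    have h2 := signWeight_le_one hθ (c x t)
    rw [vertexWeight_eq x] at h1
    linarith
  have hDm : m - 2 * (1 + θ) ^ 2 - 1 / 40 ≤ (2 + θ) * D := by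
    have h1 : m ^ 2 + θ * m - (1 + θ) < (2 + θ) * (m * (D + θ + 1) + θ * m) := by
      refine hmax.trans_lt (mul_lt_mul_of_pos_left ?_ (by linarith))
      have : vertexWeight θ c t = D + θ + 1 := by linarith
      rw [this] at havg
      linarith
    by_contra! h2
    nlinarith
  have hD0 : 0 < D := by nlinarith
  set U := negNbhd c u
  set N := posNbhd c u
  have hμ0 : (0 : ℝ) < U.card := by exact_mod_cast hc.card_negNbhd_pos u
  rcases le_or_gt (U.card : ℝ) D with hcase | hcase
  · have h1 := hc.sum_inv_card_le hθ u
    have h2 : ∑ v ∈ N, ((D - U.card) / U.card + θ)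
        ≤ ∑ v ∈ N, (((posNbhd c v \ negNbhd c u).card : ℝ) / (negNbhd c v).card) := by
      refine Finset.sum_le_sum fun v _ => ?_
      have hv0 : (0 : ℝ) < (negNbhd c v).card := by exact_mod_cast hc.card_negNbhd_pos v
      have hle : ((negNbhd c v).card : ℝ) ≤ U.card := by exact_mod_cast hu v (mem_univ v)
      have h3 : ((posNbhd c v).card : ℝ) - U.card ≤ (posNbhd c v \ negNbhd c u).card := by
        rw [sub_le_iff_le_add]
        exact_mod_cast Finset.card_le_card_sdiff_add_card
      calc (D - U.card) / U.card + θ ≤ (D - U.card) / (negNbhd c v).card + θ := by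
            gcongr
        _ = (D + θ * (negNbhd c v).card - U.card) / (negNbhd c v).card := by
            field_simp; ring
        _ ≤ _ := by
            gcongr; linarith [hdeg v]
    rw [Finset.sum_const, nsmul_eq_mul] at h2
    have h3 : (N.card : ℝ) * (D + θ * U.card) ≤ U.card * (m - U.card) := by
      have h4 : (N.card : ℝ) * ((D - U.card) / U.card + θ) * U.card
          ≤ (m - U.card - N.card) * U.card := by
        gcongr; exact h2.trans h1
      have h5 : (N.card : ℝ) * ((D - U.card) / U.card + θ) * U.card
          = N.card * (D - U.card + θ * U.card) := by field_simp
      rw [h5] at h4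
      linarith
    have h4 : (D + θ * U.card) * (D + θ * U.card) ≤ N.card * (D + θ * U.card) := by
      gcongr; exact hdeg u
    have h5 : (U.card : ℝ) * (4 * θ * D) ≤ U.card * m := by
      nlinarith [sq_nonneg (D - θ * U.card)]
    have h6 := le_of_mul_le_mul_left h5 hμ0
    nlinarith
  · have hWcard : (((univ : Finset V) \ (U ∪ N)).card : ℝ) = m - U.card - N.card := by
      rw [Finset.card_sdiff_of_subset (subset_univ _),
        Finset.card_union_of_disjoint (disjoint_negNbhd_posNbhd u), Nat.cast_sub, Nat.cast_add,
        Finset.card_univ]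
      · ring
      · rw [← Finset.card_union_of_disjoint (disjoint_negNbhd_posNbhd u)]
        exact Finset.card_le_univ _
    set W : Finset V := univ \ (U ∪ N)
    have hNu := hdeg u
    have hnu : ∀ v ∈ N, θ * (negNbhd c v).card ≤ U.card + W.card - D := by
      intro v hv
      have h1 : posNbhd c v ⊆ U ∪ W := by
        intro y hy
        have : y ∉ N := fun h =>
          hc.triangle u v y (mem_posNbhd.1 hv) (mem_posNbhd.1 hy) (mem_posNbhd.1 h)
        by_cases hyU : y ∈ U <;> simp [W, hyU, this]
      have h2 : ((posNbhd c v).card : ℝ) ≤ U.card + W.card := by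
        exact_mod_cast (Finset.card_le_card h1).trans (Finset.card_union_le _ _)
      linarith [hdeg v]
    have hbig : ∀ k : ℝ, θ * k ≤ U.card + W.card - D → k + W.card ≤ U.card := by
      intro k hk
      have e1 : (W.card : ℝ) ≤ m - D - (1 + θ) * U.card := by linarith
      have e2 : (1 + θ) * m ≤ (θ ^ 2 + 4 * θ + 2) * D := by
        have q : θ ^ 2 ≤ 19 / 7 * θ - 12 / 7 := by nlinarith
        have q1 : θ ^ 2 + 4 * θ + 2 ≤ 47 / 7 * θ + 2 / 7 := by linarith
        have q2 : 2 * (1 + θ) ^ 2 + 1 / 40 ≤ 66 / 7 * θ - 7 / 5 := by nlinarith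
        have q3 : (θ ^ 2 + 4 * θ + 2) * (2 * (1 + θ) ^ 2 + 1 / 40)
            ≤ (47 / 7 * θ + 2 / 7) * (66 / 7 * θ - 7 / 5) :=
          mul_le_mul q1 q2 (by positivity) (by linarith)
        have q4 : (θ ^ 2 + 4 * θ + 2) * (2 * (1 + θ) ^ 2 + 1 / 40) ≤ θ * m := by nlinarith
        have q5 := mul_le_mul_of_nonneg_left hDm
          (by positivity : (0 : ℝ) ≤ θ ^ 2 + 4 * θ + 2)
        refine le_of_mul_le_mul_left (?_ : (2 + θ) * _ ≤ (2 + θ) * _) (by linarith)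
        linarith
      have e3 : θ * (k + W.card) ≤ θ * U.card := by nlinarith
      exact le_of_mul_le_mul_left e3 (by linarith)
    refine hlt.not_ge ((hc.patternWeight_le_splitWeight hθ u fun z hz => ?_).trans (hsplitle _))
    have hWU : (W.card : ℝ) ≤ U.card := by
      have := hbig 0 (by rw [mul_zero]; linarith [Nat.cast_nonneg (α := ℝ) W.card])
      simpa using this
    by_cases hzN : z ∈ N
    · have h1 : posNbhd c z \ U ⊆ W := by
        intro y hy
        rw [mem_sdiff] at hy
        have : y ∉ N := fun h =>
          hc.triangle u z y (mem_posNbhd.1 hzN) (mem_posNbhd.1 hy.1) (mem_posNbhd.1 h)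
        simp [W, hy.2, this]
      exact (Finset.card_le_card h1).trans (by exact_mod_cast hWU)
    · rcases (posNbhd c z ∩ N).eq_empty_or_nonempty with h | ⟨v, h⟩
      · have h1 : posNbhd c z \ U ⊆ W := by
          intro y hy
          rw [mem_sdiff] at hy
          have : y ∉ N := fun hyN => Finset.notMem_empty y (h ▸ mem_inter.2 ⟨hy.1, hyN⟩)
          simp [W, hy.2, this]
        exact (Finset.card_le_card h1).trans (by exact_mod_cast hWU)
      · rw [mem_inter] at h
        have h1 : posNbhd c z \ U ⊆ negNbhd c v ∪ W := by
          intro y hy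
          rw [mem_sdiff] at hy
          by_cases hyN : y ∈ N
          · refine mem_union_left _ (mem_negNbhd.2 ?_)
            rcases hc.cycle v z y u (hc.symm z v ▸ mem_posNbhd.1 h.1) (mem_posNbhd.1 hy.1)
              (hc.symm u y ▸ mem_posNbhd.1 hyN) (mem_posNbhd.1 h.2) with h' | h'
            · exact h'
            · exact absurd (mem_negNbhd.2 (hc.symm z u ▸ h')) hz
          · simp [W, hy.2, hyN]
        have h2 := hbig _ (hnu v h.2)
        exact ((Finset.card_le_card h1).trans (Finset.card_union_le _ _)).trans
          (by exact_mod_cast h2)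

end Extremal

section PairSum

/-- The sum of `f` over all ordered pairs of elements of `S`. -/
def pairSum {V R : Type*} [AddCommMonoid R] (f : V → V → R) (S : Finset V) : R :=
  ∑ u ∈ S, ∑ v ∈ S, f u v

variable {V : Type*}

/-- Integer excesses `f` of a multigraph in which every `6`-set is sparse, together with
real weights `g` dominated by them. -/
structure IsSparseWeighting (θ : ℝ) (f : V → V → ℤ) (g : V → V → ℝ) : Prop where
  symm : ∀ u v, f u v = f v u
  diag : ∀ u, f u u = 0
  symm' : ∀ u v, g u v = g v u
  le : ∀ u v, g u v ≤ f u v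
  le_neg : ∀ u v, f u v < 0 → g u v ≤ -θ
  six : ∀ X : Finset V, X.card = 6 → pairSum f X ≤ 14

variable {θ : ℝ} {f : V → V → ℤ} {g : V → V → ℝ}

lemma IsSparseWeighting.pairSum_le_pairSum (hw : IsSparseWeighting θ f g) (S : Finset V) :
    pairSum g S ≤ (pairSum f S : ℤ) := by
  unfold pairSum
  push_cast
  exact Finset.sum_le_sum fun u _ => Finset.sum_le_sum fun v _ => hw.le u v

variable [DecidableEq V]

lemma pairSum_union {R : Type*} [CommRing R] {f : V → V → R} (hf : ∀ u v, f u v = f v u)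
    {X Y : Finset V} (h : Disjoint X Y) :
    pairSum f (X ∪ Y) = pairSum f X + 2 * ∑ y ∈ Y, ∑ x ∈ X, f y x + pairSum f Y := by
  have hcomm : ∑ x ∈ X, ∑ y ∈ Y, f x y = ∑ y ∈ Y, ∑ x ∈ X, f y x := by
    rw [Finset.sum_comm]
    exact Finset.sum_congr rfl fun y _ => Finset.sum_congr rfl fun x _ => hf x y
  unfold pairSum
  simp only [Finset.sum_union h, Finset.sum_add_distrib]
  rw [hcomm]
  ring

lemma pairSum_insert {R : Type*} [CommRing R] {f : V → V → R} (hf : ∀ u v, f u v = f v u)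
    (hd : ∀ u, f u u = 0) {X : Finset V} {y : V} (h : y ∉ X) :
    pairSum f (insert y X) = pairSum f X + 2 * ∑ x ∈ X, f y x := by
  rw [Finset.insert_eq, Finset.union_comm, pairSum_union hf (by simpa using h)]
  simp [pairSum, hd]

lemma even_pairSum {f : V → V → ℤ} (hf : ∀ u v, f u v = f v u) (hd : ∀ u, f u u = 0)
    (X : Finset V) : Even (pairSum f X) := by
  induction X using Finset.induction_on with
  | empty => simp [pairSum]
  | insert y X h ih => rw [pairSum_insert hf hd h]; exact ih.add (even_two_mul _)

lemma IsSparseWeighting.pairSum_le_of_card (hw : IsSparseWeighting θ f g) {m : ℕ} (hm : 6 ≤ m) :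
    ∀ S : Finset V, S.card = m → ((pairSum f S : ℤ) : ℝ) ≤ 7 / 15 * (m * (m - 1)) := by
  induction m, hm using Nat.le_induction with
  | base =>
    intro S hS
    have : ((pairSum f S : ℤ) : ℝ) ≤ 14 := by exact_mod_cast hw.six S hS
    norm_num; linarith
  | succ m hm ih =>
    intro S hS
    have hm' : (6 : ℝ) ≤ m := by exact_mod_cast hm
    have h1 : ∀ v ∈ S, pairSum f (S.erase v) = pairSum f S - 2 * ∑ x ∈ S, f v x := by
      intro v hv
      have h := pairSum_insert hw.symm hw.diag (Finset.notMem_erase v S)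
      rw [Finset.insert_erase hv] at h
      rw [h, ← Finset.add_sum_erase S (f v) hv, hw.diag]
      ring
    have h2 : ∑ v ∈ S, pairSum f (S.erase v) = (m - 1) * pairSum f S := by
      rw [Finset.sum_congr rfl h1, Finset.sum_sub_distrib, ← Finset.mul_sum, Finset.sum_const, hS]
      change (m + 1) • _ - 2 * pairSum f S = _
      rw [nsmul_eq_mul]
      push_cast
      ring
    have h3 : ((m : ℝ) - 1) * (pairSum f S : ℤ) ≤ (m + 1) * (7 / 15 * (m * (m - 1))) := by
      have h4 : ∑ v ∈ S, ((pairSum f (S.erase v) : ℤ) : ℝ) ≤ S.card • (7 / 15 * ((m : ℝ) * (m - 1))) :=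
        Finset.sum_le_card_nsmul _ _ _ fun v hv =>
          ih _ (by rw [Finset.card_erase_of_mem hv, hS]; rfl)
      rw [← Int.cast_sum, h2, hS, nsmul_eq_mul] at h4
      push_cast at h4
      exact h4
    push_cast
    refine le_of_mul_le_mul_left (h3.trans (le_of_eq ?_)) (by linarith : (0 : ℝ) < m - 1)
    ring

lemma IsSparseWeighting.pairSum_le_of_sdiff (hw : IsSparseWeighting θ f g) {S X : Finset V}
    (hXS : X ⊆ S) (hne : X.card < S.card) {e r : ℤ} (he : 2 * e ≤ pairSum f X)
    (hr : ∀ Y ⊆ S, Y.card = X.card + 1 → pairSum f Y ≤ 2 * r) :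
    pairSum g S ≤ pairSum g (S \ X) + ((S.card - X.card) * (2 * r - 2 * e) + 2 * e) := by
  have h1 := pairSum_union hw.symm' (Finset.disjoint_sdiff (s := X) (t := S))
  rw [Finset.union_sdiff_of_subset hXS] at h1
  have h2 : ∀ y ∈ S \ X, 2 * ∑ x ∈ X, g y x ≤ 2 * r - pairSum f X := by
    intro y hy
    rw [mem_sdiff] at hy
    have h3 := hr (insert y X) (Finset.insert_subset hy.1 hXS) (Finset.card_insert_of_notMem hy.2)
    rw [pairSum_insert hw.symm hw.diag hy.2] at h3
    have h4 : ((pairSum f X : ℤ) + 2 * ∑ x ∈ X, (f y x : ℝ) : ℝ) ≤ 2 * r := by exact_mod_cast h3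
    have h5 : ∑ x ∈ X, g y x ≤ ∑ x ∈ X, (f y x : ℝ) := Finset.sum_le_sum fun x _ => hw.le y x
    linarith
  have h6 := Finset.sum_le_card_nsmul _ _ _ h2
  rw [← Finset.mul_sum, nsmul_eq_mul, Finset.card_sdiff_of_subset hXS,
    Nat.cast_sub hne.le] at h6
  have h7 := hw.pairSum_le_pairSum X
  have h8 : (2 * e : ℝ) ≤ (pairSum f X : ℤ) := by exact_mod_cast he
  have h9 : (X.card : ℝ) + 1 ≤ S.card := by exact_mod_cast hne
  nlinarith

lemma pairSum_pair (hf : ∀ u v, f u v = f v u) (hd : ∀ u, f u u = 0) {x y : V} (h : x ≠ y) :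
    pairSum f {x, y} = 2 * f x y := by
  rw [pairSum_insert hf hd (by simpa using h)]
  simp [pairSum, hd]

/-- A weighting whose small sets are as sparse as those of `T_{2,1}` comes from a sign pattern. -/
lemma IsSparseWeighting.pairSum_le_of_sparse (hθ : 1 ≤ θ) (hθ' : θ ≤ 12 / 7)
    (hw : IsSparseWeighting θ f g) {S : Finset V} (hS : 120 ≤ S.card)
    (h2 : ∀ X ⊆ S, X.card = 2 → pairSum f X ≤ 2) (h3 : ∀ X ⊆ S, X.card = 3 → pairSum f X ≤ 4)
    (h4 : ∀ X ⊆ S, X.card = 4 → pairSum f X ≤ 6) :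
    pairSum g S ≤ maxSplitWeight θ S.card := by
  let c : S → S → SignType := fun x y => if x = y then -1 else SignType.sign (f x y)
  have hne : ∀ {x y : S}, c x y = 1 → (x : V) ≠ y ∧ 1 ≤ f x y := by
    intro x y h
    by_cases hxy : x = y
    · simp [c, hxy] at h
    · simp only [c, hxy, if_false, sign_eq_one_iff] at h
      exact ⟨fun h' => hxy (Subtype.ext h'), h⟩
  have hnn : ∀ {x y : S}, c x y ≠ -1 → (x : V) ≠ y ∧ 0 ≤ f x y := by
    intro x y h
    by_cases hxy : x = y
    · simp [c, hxy] at h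
    · simp only [c, hxy, if_false, ne_eq, sign_eq_neg_one_iff, not_lt] at h
      exact ⟨fun h' => hxy (Subtype.ext h'), h⟩
  have hc : IsSignPattern c :=
    { symm := fun u v => by simp only [c, eq_comm (a := u), hw.symm (u : V)]
      diag := fun u => by simp [c]
      triangle := by
        intro u v w huv hvw huw
        have e1 := hne huv
        have e2 := hne hvw
        have e3 := hne huw
        have h := h3 {(u : V), (v : V), (w : V)} (by simp [Finset.insert_subset_iff])
          (Finset.card_eq_three.2 ⟨_, _, _, e1.1, e3.1, e2.1, rfl⟩)
        rw [pairSum_insert hw.symm hw.diag (by simp [e1.1, e3.1]),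
          pairSum_pair hw.symm hw.diag e2.1, Finset.sum_pair e2.1] at h
        omega
      cycle := by
        intro x u y v hxu huy hyv hvx
        by_contra! hcon
        have e1 := hne hxu
        have e2 := hne huy
        have e3 := hne hyv
        have e4 := hne hvx
        have e5 := hnn hcon.1
        have e6 := hnn hcon.2
        have h := h4 {(x : V), (u : V), (y : V), (v : V)} (by simp [Finset.insert_subset_iff])
          (by rw [Finset.card_insert_of_notMem (by simp [e1.1, e5.1, e4.1.symm]),
            Finset.card_insert_of_notMem (by simp [e2.1, e6.1]),
            Finset.card_pair e3.1])
        rw [pairSum_insert hw.symm hw.diag (by simp [e1.1, e5.1, e4.1.symm]),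
          pairSum_insert hw.symm hw.diag (by simp [e2.1, e6.1]),
          pairSum_pair hw.symm hw.diag e3.1,
          Finset.sum_pair e3.1, Finset.sum_insert (by simp [e2.1, e6.1]),
          Finset.sum_pair e3.1, hw.symm x v] at h
        omega }
  obtain ⟨c', hc', hle⟩ := exists_isMaxPattern θ hc
  have hmax := hc'.patternWeight_le hθ hθ' (by simpa using hS)
  rw [Fintype.card_coe] at hmax
  refine le_trans ?_ ((add_le_add_left hle _).trans hmax)
  have hpt : ∀ x y : S, g x y ≤ signWeight θ (c x y) + if x = y then θ else 0 := by
    intro x y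
    by_cases hxy : x = y
    · subst hxy
      have := hw.le x x
      rw [hw.diag] at this
      simpa [c, signWeight] using this
    · have hxy' : (x : V) ≠ y := fun h => hxy (Subtype.ext h)
      simp only [c, hxy, if_false, add_zero]
      have hle := hw.le x y
      rcases lt_trichotomy (f x y) 0 with h | h | h
      · rw [sign_neg h]
        simpa [signWeight] using hw.le_neg _ _ h
      · rw [h] at hle ⊢
        simpa [signWeight] using hle
      · rw [sign_pos h]
        have h5 := h2 {(x : V), (y : V)} (by simp [Finset.insert_subset_iff])
          (Finset.card_pair hxy')
        rw [pairSum_pair hw.symm hw.diag hxy'] at h5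
        have h6 : (f x y : ℝ) ≤ 1 := by exact_mod_cast (by omega : f x y ≤ 1)
        simpa [signWeight] using hle.trans h6
  calc pairSum g S = ∑ x : S, ∑ y : S, g x y := by
        unfold pairSum
        rw [← Finset.sum_coe_sort S]
        exact Finset.sum_congr rfl fun x _ => (Finset.sum_coe_sort S (g x)).symm
    _ ≤ ∑ x : S, ∑ y : S, (signWeight θ (c x y) + if x = y then θ else 0) :=
        Finset.sum_le_sum fun x _ => Finset.sum_le_sum fun y _ => hpt x y
    _ = patternWeight θ c + θ * S.card := by
        simp [Finset.sum_add_distrib, patternWeight, mul_comm]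

lemma maxSplitWeight_add_le (hθ : 1 ≤ θ) {m s : ℕ} (hm : 1 ≤ m) :
    maxSplitWeight θ m + 2 * (s * bestSplit θ m) ≤ maxSplitWeight θ (m + s) := by
  refine le_trans (le_of_eq ?_) (splitWeight_le_max hθ (by omega) (bestSplit θ m))
  unfold maxSplitWeight splitWeight
  push_cast
  ring

lemma maxSplitWeight_add_le' (hθ : 1 ≤ θ) {m s : ℕ} (hm : 1 ≤ m) :
    maxSplitWeight θ m + 2 * (m + s - 1 + (s - 2 - θ) * bestSplit θ m)
      ≤ maxSplitWeight θ (m + s) := by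
  refine le_trans (le_of_eq ?_) (splitWeight_le_max hθ (by omega) (bestSplit θ m + 1))
  unfold maxSplitWeight splitWeight
  push_cast
  ring

/-- A slack term that decreases fast enough to absorb the deletion of dense small sets, and
vanishes for `m ≥ 503`. -/
noncomputable def slack (m : ℕ) : ℝ := max 0 ((503 : ℝ) ^ 2 - (m : ℝ) ^ 2)

lemma IsSparseWeighting.pairSum_le_add (hθ : 1 ≤ θ) (hθ' : θ ≤ 12 / 7)
    (hw : IsSparseWeighting θ f g) (S : Finset V) (hS : 115 ≤ S.card) :
    pairSum g S ≤ maxSplitWeight θ S.card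
      + 7 / 500 * slack S.card := by
  induction hm : S.card using Nat.strong_induction_on generalizing S with
  | _ m ih =>
  subst hm
  have hmax := le_maxSplitWeight hθ (m := S.card) (by omega)
  have hm1 : (115 : ℝ) ≤ S.card := by exact_mod_cast hS
  rcases lt_or_ge S.card 120 with hlt | hge
  · have h1 := hw.pairSum_le_pairSum S
    have h2 := hw.pairSum_le_of_card (by omega) S rfl
    have h3 : (503 : ℝ) ^ 2 - (S.card : ℝ) ^ 2 ≤ slack S.card := le_max_right _ _
    have hm2 : (S.card : ℝ) ≤ 120 := by exact_mod_cast hlt.le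
    have h4 : (26 : ℝ) / 7 * maxSplitWeight θ S.card ≥ (S.card : ℝ) ^ 2 := by
      by_contra! h
      nlinarith
    nlinarith
  have hm2 : (120 : ℝ) ≤ S.card := by exact_mod_cast hge
  have step : ∀ (s : ℕ) (e r : ℤ), 2 ≤ s → s ≤ 5 → (∃ X ⊆ S, X.card = s ∧ 2 * e ≤ pairSum f X) →
      (∀ Y ⊆ S, Y.card = s + 1 → pairSum f Y ≤ 2 * r) →
      (∀ k : ℕ, ∀ m : ℕ, m + s = S.card → (S.card - s - 1 : ℝ) * 7 / 26 ≤ k →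
        maxSplitWeight θ m + 2 * (s * k) ≤ maxSplitWeight θ S.card →
        maxSplitWeight θ m + 2 * (S.card - 1 + (s - 2 - θ) * k) ≤ maxSplitWeight θ S.card →
        maxSplitWeight θ m + ((S.card - s) * (2 * r - 2 * e) + 2 * e)
          + 7 / 500 * (s * (2 * S.card - s)) ≤ maxSplitWeight θ S.card) →
      pairSum g S ≤ maxSplitWeight θ S.card
        + 7 / 500 * slack S.card := by
    rintro s e r hs2 hs5 ⟨X, hXS, rfl, he⟩ hr hnum
    obtain ⟨m, hm⟩ : ∃ m, m + X.card = S.card := ⟨S.card - X.card, by omega⟩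
    have hcard : (S \ X).card = m := by rw [Finset.card_sdiff_of_subset hXS]; omega
    have h1 := hw.pairSum_le_of_sdiff hXS (by omega) he hr
    have h2 := ih m (by omega) (S \ X) (by omega) hcard
    have hmS : (m : ℝ) + X.card = S.card := by exact_mod_cast hm
    have h3 := hnum (bestSplit θ m) m hm ?_ (by
      rw [← hm]; exact maxSplitWeight_add_le hθ (by omega)) (by
      have := maxSplitWeight_add_le' hθ (m := m) (s := X.card) (by omega)
      rwa [hm, hmS] at this)
    · have hX5 : (X.card : ℝ) ≤ 5 := by exact_mod_cast hs5
      have h4 : slack m ≤ slack S.card + X.card * (2 * S.card - X.card) := by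
        have h5 : (0 : ℝ) ≤ X.card * (2 * S.card - X.card) :=
          mul_nonneg (Nat.cast_nonneg _) (by linarith)
        refine max_le (add_nonneg (le_max_left _ _) h5) ?_
        have h6 : (503 : ℝ) ^ 2 - (S.card : ℝ) ^ 2 ≤ slack S.card := le_max_right _ _
        have h7 : (m : ℝ) = S.card - X.card := by linarith
        rw [h7]
        nlinarith
      linarith
    · have h4 := le_bestSplit hθ m
      have h5 : (m : ℝ) = S.card - X.card := by linarith
      have h6 : (2 + θ) * bestSplit θ m ≤ (26 / 7) * bestSplit θ m := by
        gcongr; linarith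
      rw [h5] at h4
      linarith
  have even_lt : ∀ (X : Finset V) (k : ℤ), ¬ (2 * (k + 1) ≤ pairSum f X) → pairSum f X ≤ 2 * k := by
    intro X k h
    obtain ⟨t, ht⟩ := even_pairSum hw.symm hw.diag X
    omega
  by_cases h5 : ∃ X ⊆ S, X.card = 5 ∧ 2 * 6 ≤ pairSum f X
  · refine step 5 6 7 (by omega) (by omega) h5 (fun Y _ hY => hw.six Y hY) ?_
    intro k m _ hk _ h
    push_cast at hk h ⊢
    nlinarith
  push Not at h5
  by_cases h4 : ∃ X ⊆ S, X.card = 4 ∧ 2 * 4 ≤ pairSum f X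
  · refine step 4 4 5 (by omega) (by omega) h4
      (fun Y hY hY' => even_lt Y 5 (not_le.2 (h5 Y hY hY'))) ?_
    intro k m _ hk _ h
    push_cast at hk h ⊢
    nlinarith
  push Not at h4
  by_cases h3 : ∃ X ⊆ S, X.card = 3 ∧ 2 * 3 ≤ pairSum f X
  · refine step 3 3 3 (by omega) (by omega) h3
      (fun Y hY hY' => even_lt Y 3 (not_le.2 (h4 Y hY hY'))) ?_
    intro k m _ hk h _
    push_cast at hk h ⊢
    linarith
  push Not at h3
  by_cases h2 : ∃ X ⊆ S, X.card = 2 ∧ 2 * 2 ≤ pairSum f X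
  · refine step 2 2 2 (by omega) (by omega) h2
      (fun Y hY hY' => even_lt Y 2 (not_le.2 (h3 Y hY hY'))) ?_
    intro k m _ hk h _
    push_cast at hk h ⊢
    linarith
  push Not at h2
  have := hw.pairSum_le_of_sparse hθ hθ' hge
    (fun Y hY hY' => even_lt Y 1 (not_le.2 (h2 Y hY hY')))
    (fun Y hY hY' => even_lt Y 2 (not_le.2 (h3 Y hY hY')))
    (fun Y hY hY' => even_lt Y 3 (not_le.2 (h4 Y hY hY')))
  have h6 : 0 ≤ slack S.card := le_max_left _ _
  linarith

lemma IsSparseWeighting.pairSum_le (hθ : 1 ≤ θ) (hθ' : θ ≤ 12 / 7)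
    (hw : IsSparseWeighting θ f g) (S : Finset V) (hS : 503 ≤ S.card) :
    pairSum g S ≤ maxSplitWeight θ S.card := by
  have h := hw.pairSum_le_add hθ hθ' S (by omega)
  have hS' : (503 : ℝ) ≤ S.card := by exact_mod_cast hS
  rwa [slack, max_eq_left (by nlinarith), mul_zero, add_zero] at h

end PairSum

section Multigraph

/-- The function on ordered pairs induced by a function on edges, vanishing on the diagonal. -/
def pairWeight {V R : Type*} [DecidableEq V] [Zero R] (F : Finset V → R) (u v : V) : R :=
  if u = v then 0 else F {u, v}

lemma pairWeight_comm {V R : Type*} [DecidableEq V] [Zero R] (F : Finset V → R) (u v : V) :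
    pairWeight F u v = pairWeight F v u := by
  simp only [pairWeight, eq_comm (a := u), pair_comm u]

lemma pairWeight_self {V R : Type*} [DecidableEq V] [Zero R] (F : Finset V → R) (u : V) :
    pairWeight F u u = 0 := if_pos rfl

lemma pairSum_pairWeight {V R : Type*} [DecidableEq V] [CommRing R] (F : Finset V → R)
    (X : Finset V) : pairSum (pairWeight F) X = 2 * ∑ p ∈ X.powersetCard 2, F p := by
  induction X using Finset.induction_on with
  | empty => simp [pairSum, powersetCard_eq_empty.2 (show #(∅ : Finset V) < 2 by simp)]
  | insert a X ha ih =>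
    rw [pairSum_insert (pairWeight_comm F) (pairWeight_self F) ha, ih, powersetCard_succ_insert ha,
      sum_union, mul_add, sum_image, powersetCard_one, sum_map]
    · congr 2
      refine sum_congr rfl fun x hx => ?_
      rw [pairWeight, if_neg (fun h : a = x => ha (h ▸ hx))]
      rfl
    · intro s hs t ht h
      have hs' := (mem_powersetCard.1 hs).1
      have ht' := (mem_powersetCard.1 ht).1
      rw [← erase_insert (fun h => ha (hs' h)), h, erase_insert (fun h => ha (ht' h))]
    · rw [disjoint_left]
      intro s hs ht
      obtain ⟨t, -, rfl⟩ := mem_image.1 ht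
      exact ha ((mem_powersetCard.1 hs).1 (mem_insert_self _ _))

/-- The weighting with two parts (the vertices in `p` and the others), where pairs inside `p` have
weight `-θ`, pairs inside the other part `0` and crossing pairs `1`. -/
def splitWeighting {V : Type*} [DecidableEq V] (θ : ℝ) (p : V → Prop) [DecidablePred p]
    (u v : V) : ℝ :=
  if u = v then 0 else if p u ↔ p v then (if p u then -θ else 0) else 1

lemma pairSum_splitWeighting {V : Type*} [DecidableEq V] (θ : ℝ) (p : V → Prop) [DecidablePred p]
    (X : Finset V) :
    pairSum (splitWeighting θ p) X = splitWeight θ X.card (X.filter p).card := by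
  induction X using Finset.induction_on with
  | empty => simp [pairSum, splitWeight]
  | insert a X ha ih =>
    have hne : ∀ x ∈ X, a ≠ x := fun x hx h => ha (h ▸ hx)
    have hcard : ((X.filter p).card : ℝ) + (X.filter fun x => ¬ p x).card = X.card := by
      exact_mod_cast card_filter_add_card_filter_not p
    have hsymm : ∀ u v, splitWeighting θ p u v = splitWeighting θ p v u := by
      intro u v
      unfold splitWeighting
      by_cases h : p u <;> by_cases h' : p v <;> simp [h, h', eq_comm (a := u)]
    rw [pairSum_insert hsymm (fun u => if_pos rfl) ha, ih, card_insert_of_notMem ha, filter_insert]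
    by_cases h : p a
    · rw [if_pos h, card_insert_of_notMem (fun h => ha (mem_filter.1 h).1)]
      have : ∑ x ∈ X, splitWeighting θ p a x
          = (X.filter p).card * (-θ) + (X.filter fun x => ¬ p x).card * 1 := by
        rw [← sum_filter_add_sum_filter_not X p]
        congr 1
        · rw [← nsmul_eq_mul, ← sum_const]
          refine sum_congr rfl fun x hx => ?_
          obtain ⟨hx, hp⟩ := mem_filter.1 hx
          simp [splitWeighting, hne x hx, h, hp]
        · rw [← nsmul_eq_mul, ← sum_const]
          refine sum_congr rfl fun x hx => ?_
          obtain ⟨hx, hp⟩ := mem_filter.1 hx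
          simp [splitWeighting, hne x hx, h, hp]
      rw [this, ← hcard]
      push_cast
      rw [← hcard]
      unfold splitWeight
      ring
    · rw [if_neg h]
      have : ∑ x ∈ X, splitWeighting θ p a x = (X.filter p).card := by
        rw [card_filter, Nat.cast_sum]
        refine sum_congr rfl fun x hx => ?_
        by_cases hp : p x <;> simp [splitWeighting, hne x hx, h, hp]
      rw [this]
      push_cast
      unfold splitWeight
      ring

/-- The multiplicity `w` on a logarithmic scale on which `a` has weight `0` and `a + 1` has
weight `1`. -/
noncomputable def logWeight (a w : ℕ) : ℝ := Real.log (w / a) / Real.log ((a + 1) / a)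

/-- The penalty `-logWeight a (a - 1)` of an edge of multiplicity `a - 1`. -/
noncomputable def logPenalty (a : ℕ) : ℝ := Real.log (a / (a - 1)) / Real.log ((a + 1) / a)

lemma log_succ_div_pos {a : ℕ} (ha : 1 ≤ a) : 0 < Real.log (((a : ℝ) + 1) / a) := by
  have ha' : (0 : ℝ) < a := by exact_mod_cast ha
  refine Real.log_pos ?_
  rw [lt_div_iff₀ ha']
  linarith

lemma log_eq_add_logWeight {a w : ℕ} (ha : 1 ≤ a) (hw : 1 ≤ w) :
    Real.log w = Real.log a + Real.log ((a + 1) / a) * logWeight a w := by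
  have ha' : (a : ℝ) ≠ 0 := by positivity
  have hw' : (w : ℝ) ≠ 0 := by positivity
  rw [logWeight, mul_div_cancel₀ _ (log_succ_div_pos ha).ne', Real.log_div hw' ha']
  ring

lemma logWeight_le {a w : ℕ} (ha : 1 ≤ a) (hw : 1 ≤ w) : logWeight a w ≤ (w : ℝ) - a := by
  have ha' : (0 : ℝ) < a := by exact_mod_cast ha
  have hw' : (0 : ℝ) < w := by exact_mod_cast hw
  rw [logWeight, div_le_iff₀ (log_succ_div_pos ha)]
  rcases le_total a w with h | h
  · obtain ⟨t, rfl⟩ := Nat.exists_eq_add_of_le h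
    have hB := one_add_mul_le_pow (a := 1 / (a : ℝ)) (by linarith [one_div_pos.2 ha']) t
    have e1 : ((a + t : ℕ) : ℝ) / a = 1 + t * (1 / a) := by push_cast; field_simp
    have e2 : ((a : ℝ) + 1) / a = 1 + 1 / a := by field_simp
    have e3 : ((a + t : ℕ) : ℝ) - a = t := by push_cast; ring
    rw [e1, e2, e3, ← Real.log_pow]
    exact Real.log_le_log (by positivity) hB
  · have h' : (w : ℝ) ≤ a := by exact_mod_cast h
    have h1 := Real.log_le_sub_one_of_pos (div_pos hw' ha')
    have h2 := Real.log_le_sub_one_of_pos (x := ((a : ℝ) + 1) / a) (by positivity)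
    have e1 : (w : ℝ) / a - 1 = (w - a) * (((a : ℝ) + 1) / a - 1) := by field_simp; ring
    rw [e1] at h1
    exact h1.trans (mul_le_mul_of_nonpos_left h2 (by linarith))

lemma logWeight_mono {a w w' : ℕ} (ha : 1 ≤ a) (hw : 1 ≤ w) (h : w ≤ w') :
    logWeight a w ≤ logWeight a w' := by
  have ha' : (0 : ℝ) < a := by exact_mod_cast ha
  have hw' : (0 : ℝ) < w := by exact_mod_cast hw
  have := log_succ_div_pos ha
  unfold logWeight
  gcongr

lemma logWeight_self {a : ℕ} (ha : 1 ≤ a) : logWeight a a = 0 := by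
  have ha' : (a : ℝ) ≠ 0 := by positivity
  simp [logWeight, ha']

lemma logWeight_succ {a : ℕ} (ha : 1 ≤ a) : logWeight a (a + 1) = 1 := by
  have := (log_succ_div_pos ha).ne'
  rw [logWeight]
  push_cast
  exact div_self this

lemma logWeight_pred {a : ℕ} (ha : 1 ≤ a) : logWeight a (a - 1) = -logPenalty a := by
  rw [logWeight, logPenalty, Nat.cast_sub ha, Nat.cast_one, ← neg_div, ← Real.log_inv, inv_div]

lemma one_le_logPenalty {a : ℕ} (ha : 2 ≤ a) : 1 ≤ logPenalty a := by
  have ha' : (2 : ℝ) ≤ a := by exact_mod_cast ha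
  rw [logPenalty, one_le_div (log_succ_div_pos (by lia))]
  refine Real.log_le_log (by positivity) ?_
  rw [div_le_div_iff₀ (by linarith) (by linarith)]
  linarith

lemma logPenalty_le {a : ℕ} (ha : 2 ≤ a) : logPenalty a ≤ 12 / 7 := by
  rw [logPenalty, div_le_div_iff₀ (log_succ_div_pos (by lia)) (by norm_num)]
  have key : a ^ 19 ≤ (a + 1) ^ 12 * (a - 1) ^ 7 := by
    obtain ⟨b, rfl⟩ := Nat.exists_eq_add_of_le' ha
    have : b + 2 - 1 = b + 1 := rfl
    rw [this]
    ring_nf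
    gcongr <;> norm_num
  have ha' : (2 : ℝ) ≤ a := by exact_mod_cast ha
  have ha1 : (0 : ℝ) < a - 1 := by linarith
  have key' : (a : ℝ) ^ 19 ≤ (a + 1) ^ 12 * (a - 1) ^ 7 := by
    have := (Nat.cast_le (α := ℝ)).2 key
    push_cast [Nat.cast_sub (show 1 ≤ a by lia)] at this
    exact this
  have : (7 : ℕ) * Real.log (a / (a - 1)) ≤ (12 : ℕ) * Real.log ((a + 1) / a) := by
    rw [← Real.log_pow, ← Real.log_pow]
    refine Real.log_le_log (by positivity) ?_
    rw [div_pow, div_pow, div_le_div_iff₀ (by positivity) (by positivity)]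
    calc (a : ℝ) ^ 7 * a ^ 12 = a ^ 19 := by ring
      _ ≤ _ := key'
  push_cast at this
  linarith

variable {n a : ℕ} {w : Finset (Fin n) → ℕ}

lemma log_edgeProd (ha : 1 ≤ a) (X : Finset (Fin n)) (hw : ∀ p ∈ X.powersetCard 2, 1 ≤ w p) :
    Real.log (edgeProd n w X) = X.card.choose 2 * Real.log a
      + Real.log ((a + 1) / a) / 2 * pairSum (pairWeight fun p => logWeight a (w p)) X := by
  rw [pairSum_pairWeight, edgeProd, Nat.cast_prod, Real.log_prod
    (fun p hp => Nat.cast_ne_zero.2 (Nat.one_le_iff_ne_zero.1 (hw p hp))),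
    sum_congr rfl fun p hp => log_eq_add_logWeight ha (hw p hp), sum_add_distrib, ← mul_sum,
    sum_const, card_powersetCard, nsmul_eq_mul]
  ring

lemma IsF.isSparseWeighting (ha : 1 ≤ a) (hF : IsF n 6 (15 * a + 7) w)
    (hw : ∀ u v, u ≠ v → 1 ≤ w {u, v}) :
    IsSparseWeighting (logPenalty a) (pairWeight fun p => (w p : ℤ) - a)
      (pairWeight fun p => logWeight a (w p)) where
  symm := pairWeight_comm _
  diag := pairWeight_self _
  symm' := pairWeight_comm _
  le u v := by
    by_cases h : u = v
    · simp [pairWeight, h]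
    · simpa [pairWeight, h] using logWeight_le ha (hw u v h)
  le_neg u v h := by
    by_cases huv : u = v
    · simp [pairWeight, huv] at h
    · simp only [pairWeight, huv, if_false] at h ⊢
      rw [← logWeight_pred ha]
      exact logWeight_mono ha (hw u v huv) (by lia)
  six X hX := by
    have h := hF X hX
    unfold edgeSum at h
    rw [pairSum_pairWeight, sum_sub_distrib, sum_const, card_powersetCard, hX]
    have h' : (∑ p ∈ X.powersetCard 2, (w p : ℤ)) ≤ 15 * a + 7 := by exact_mod_cast h
    have : Nat.choose 6 2 = 15 := rfl
    rw [this, nsmul_eq_mul]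
    push_cast
    linarith

lemma InT.exists_pred (h : InT n 2 1 a w) : ∃ f : Fin n → ℕ, ∀ u v, u ≠ v →
    w {u, v} = if f u = 0 ↔ f v = 0 then (if f u = 0 then a - 1 else a) else a + 1 := by
  obtain ⟨f, hf, h⟩ := h
  refine ⟨f, fun u v huv => ?_⟩
  have hu := hf u
  have hv := hf v
  rw [h u v huv]
  have : f u = f v ↔ (f u = 0 ↔ f v = 0) := by lia
  simp only [this]

lemma InT.isF (ha : 1 ≤ a) (h : InT n 2 1 a w) : IsF n 6 (15 * a + 7) w := by
  intro X hX
  obtain ⟨f, hf⟩ := h.exists_pred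
  have h1 : pairWeight (fun p => (w p : ℝ) - a) = splitWeighting 1 fun v => f v = 0 := by
    funext u v
    unfold pairWeight splitWeighting
    by_cases huv : u = v
    · simp [huv]
    · simp only [huv, if_false, hf u v huv]
      split_ifs
      · push_cast [ha]; ring
      · ring
      · push_cast; ring
  have h2 := pairSum_pairWeight (fun p => (w p : ℝ) - a) X
  rw [h1, pairSum_splitWeighting, sum_sub_distrib, sum_const, card_powersetCard, hX,
    nsmul_eq_mul] at h2
  have hk : (X.filter fun v => f v = 0).card ≤ 6 := hX ▸ card_filter_le _ _
  have h3 : splitWeight 1 (6 : ℕ) (X.filter fun v => f v = 0).card ≤ 14 := by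
    unfold splitWeight
    generalize (X.filter fun v => f v = 0).card = k at hk
    interval_cases k <;> norm_num
  have h4 : ((Nat.choose 6 2 : ℕ) : ℝ) = 15 := by norm_num [Nat.choose]
  rw [h4] at h2
  have : ((edgeSum n w X : ℕ) : ℝ) ≤ (15 * a + 7 : ℕ) := by
    unfold edgeSum
    push_cast
    linarith
  exact_mod_cast this

lemma InT.le_succ (h : InT n 2 1 a w) {p : Finset (Fin n)} (hp : p.card = 2) : w p ≤ a + 1 := by
  obtain ⟨f, -, h⟩ := h
  obtain ⟨u, v, huv, rfl⟩ := card_eq_two.1 hp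
  rw [h u v huv]
  split_ifs <;> lia

lemma InT.edgeProd_le (h : InT n 2 1 a w) :
    edgeProd n w univ ≤ (a + 1) ^ (univ.powersetCard 2 : Finset (Finset (Fin n))).card :=
  prod_le_pow_card _ _ _ fun _ hp => h.le_succ (mem_powersetCard.1 hp).2

/-- The member of `T_{2,1}(a, n)` whose sparse part consists of the first `k` vertices. -/
def splitGraph (n a k : ℕ) (p : Finset (Fin n)) : ℕ :=
  if ∀ v ∈ p, v.val < k then a - 1 else if ∀ v ∈ p, ¬ v.val < k then a else a + 1

lemma splitGraph_pair (n a k : ℕ) (u v : Fin n) : splitGraph n a k {u, v} =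
    if u.val < k ↔ v.val < k then (if u.val < k then a - 1 else a) else a + 1 := by
  by_cases hu : u.val < k <;> by_cases hv : v.val < k <;> simp [splitGraph, hu, hv]

lemma inT_splitGraph (n a k : ℕ) : InT n 2 1 a (splitGraph n a k) := by
  refine ⟨fun v => if v.val < k then 0 else 1, fun v => by dsimp only; split_ifs <;> lia,
    fun u v _ => ?_⟩
  rw [splitGraph_pair]
  by_cases hu : u.val < k <;> by_cases hv : v.val < k <;> simp [hu, hv]

lemma log_edgeProd_splitGraph {k : ℕ} (ha : 2 ≤ a) (hk : k ≤ n) :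
    Real.log (edgeProd n (splitGraph n a k) univ) = n.choose 2 * Real.log a
      + Real.log ((a + 1) / a) / 2 * splitWeight (logPenalty a) n k := by
  have ha1 : 1 ≤ a := by lia
  have hcard : ((univ : Finset (Fin n)).filter fun v => v.val < k).card = k := by
    rw [Fin.card_filter_val_lt]
    lia
  have h : (pairWeight fun p => logWeight a (splitGraph n a k p))
      = splitWeighting (logPenalty a) fun v => v.val < k := by
    funext u v
    unfold pairWeight splitWeighting
    simp only [splitGraph_pair]
    split_ifs
    · rfl
    · exact logWeight_pred ha1
    · exact logWeight_self ha1
    · exact logWeight_succ ha1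
  rw [log_edgeProd ha1, h, pairSum_splitWeighting, hcard, card_univ, Fintype.card_fin]
  intro p _
  unfold splitGraph
  split_ifs <;> lia

lemma edgeProd_splitGraph_pos (ha : 2 ≤ a) (k : ℕ) : 0 < edgeProd n (splitGraph n a k) univ := by
  refine prod_pos fun p _ => ?_
  unfold splitGraph
  split_ifs <;> lia

lemma IsF.edgeProd_le (ha : 2 ≤ a) (hn : 503 ≤ n) (hF : IsF n 6 (15 * a + 7) w) :
    edgeProd n w univ ≤ edgeProd n (splitGraph n a (bestSplit (logPenalty a) n)) univ := by
  by_cases hw : ∀ p ∈ (univ : Finset (Fin n)).powersetCard 2, 1 ≤ w p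
  · have h1 := (hF.isSparseWeighting (by lia) fun u v huv => hw _
      (mem_powersetCard.2 ⟨subset_univ _, card_pair huv⟩)).pairSum_le (one_le_logPenalty ha)
      (logPenalty_le ha) univ (by simpa using hn)
    have h2 := log_edgeProd (a := a) (by lia) univ hw
    have h3 := log_edgeProd_splitGraph ha
      (bestSplit_le_self (one_le_logPenalty ha) (show 1 ≤ n by lia))
    rw [card_univ, Fintype.card_fin] at h1 h2
    have hα := log_succ_div_pos (show 1 ≤ a by lia)
    have h4 : Real.log (edgeProd n w univ)
        ≤ Real.log (edgeProd n (splitGraph n a (bestSplit (logPenalty a) n)) univ) := by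
      rw [h2, h3]
      gcongr
      exact h1
    rw [Real.log_le_log_iff (Nat.cast_pos.2 (show 0 < edgeProd n w univ from prod_pos hw))
      (Nat.cast_pos.2 (edgeProd_splitGraph_pos ha _))] at h4
    exact_mod_cast h4
  · push Not at hw
    obtain ⟨p, hp, h0⟩ := hw
    have : edgeProd n w univ = 0 := prod_eq_zero hp (by lia)
    rw [this]
    exact Nat.zero_le _

end Multigraph

/-- For all integers `a ≥ 2` and `n ≥ 503`,
`ex_Π(n, 6, 15a + 7) = Π_{2,1}(a, n)`. -/
theorem exPi_six (a n : ℕ) (ha : 2 ≤ a) (hn : 503 ≤ n) :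
    exPi n 6 (15 * a + 7) = PiT 2 1 a n := by
  have hT : InT n 2 1 a (splitGraph n a (bestSplit (logPenalty a) n)) := inT_splitGraph n a _
  unfold exPi PiT
  refine le_antisymm (csSup_le ⟨_, _, hT.isF (by lia), rfl⟩ ?_) (csSup_le ⟨_, _, hT, rfl⟩ ?_)
  · rintro _ ⟨w, hw, rfl⟩
    refine (hw.edgeProd_le ha hn).trans (le_csSup
      ⟨(a + 1) ^ (univ.powersetCard 2 : Finset (Finset (Fin n))).card, ?_⟩ ⟨_, hT, rfl⟩)
    rintro _ ⟨w', hw', rfl⟩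
    exact hw'.edgeProd_le
  · rintro _ ⟨w, hw, rfl⟩
    refine le_csSup ⟨edgeProd n (splitGraph n a (bestSplit (logPenalty a) n)) univ, ?_⟩
      ⟨w, hw.isF (by lia), rfl⟩
    rintro _ ⟨w', hw', rfl⟩
    exact hw'.edgeProd_le ha hn
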